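/- Theorem (Nash, 1950). Every finite strategic-form game (finitely many players, each with a nonempty finite strategy set, and arbitrary real-valued utilities) possesses a mixed-strategy Nash equilibrium: there exist probability distributions q_1*,...,q_K*, with q_i* a distribution on S_i, such that for every player i and every probability distribution q_i' on S_i, the expected utility ũ_i(q_i*, q_{-i}*) ≥ ũ_i(q_i', q_{-i}*), where ũ_i(q_1,...,q_K) = Σ_{s ∈ S_1×...×S_K} (Π_j q_j(s_j)) u_i(s). -/

import Mathlib

/-- A finite set `R` is dominant for a family of rankings `a i` if no point lies strictly above
the `a i`-minimum of `R` for every `i`. -/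
def IsDominant {X I : Type*} (a : I → X → ℕ) (R : Finset X) : Prop :=
  ∀ y, ∃ i, ∀ x ∈ R, a i y ≤ a i x

theorem IsDominant.subset {X I : Type*} {a : I → X → ℕ} {R D : Finset X}
    (h : IsDominant a R) (hD : D ⊆ R) : IsDominant a D := fun y =>
  (h y).imp fun _ hi x hx => hi x (hD hx)

/-- A surjection onto a finite set with one element fewer than its domain identifies exactly one
pair, and only a member of that pair can be removed from the domain. -/
theorem exists_pair_of_surjective_card_add_one {X I : Type*} [Fintype I] {D : Finset X}
    (hcard : D.card + 1 = Fintype.card I) {m : I → X} (hm : ∀ i, m i ∈ D) :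
    ∃ j k, j ≠ k ∧ m j = m k ∧ ∀ L : Set I, L.Nonempty → (∀ d ∈ D, ∃ i ∉ L, m i = d) →
      L = {j} ∨ L = {k} := by
  classical
  obtain ⟨j, -, k, -, hjk, hmjk⟩ := Finset.exists_ne_map_eq_of_card_lt_of_maps_to
    (s := (Finset.univ : Finset I)) (t := D) (f := m)
    (by rw [Finset.card_univ]; omega) (fun i _ => hm i)
  refine ⟨j, k, hjk, hmjk, fun L hL hsurj => ?_⟩
  obtain ⟨l, hl⟩ := hL
  have himg : D ⊆ (Finset.univ.filter (· ∉ L)).image m := fun d hd => by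
    obtain ⟨i, hi, rfl⟩ := hsurj d hd
    exact Finset.mem_image_of_mem _ (by simpa using hi)
  have hsub : Finset.univ.filter (· ∉ L) ⊆ Finset.univ.erase l := fun i hi => by
    simp only [Finset.mem_filter, Finset.mem_univ, true_and] at hi
    simp only [Finset.mem_erase, Finset.mem_univ, and_true]
    rintro rfl
    exact hi hl
  have hle := Finset.card_le_card himg
  have hle' := Finset.card_le_card hsub
  have hle'' := Finset.card_image_le (s := Finset.univ.filter (· ∉ L)) (f := m)
  rw [Finset.card_erase_of_mem (Finset.mem_univ l), Finset.card_univ] at hle'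
  have heq : Finset.univ.filter (· ∉ L) = Finset.univ.erase l :=
    Finset.eq_of_subset_of_card_le hsub (by
      rw [Finset.card_erase_of_mem (Finset.mem_univ l), Finset.card_univ]; omega)
  have hinj : Set.InjOn m (Finset.univ.filter (· ∉ L) : Finset I) :=
    Finset.card_image_iff.mp (by omega)
  have hLl : L = {l} := by
    ext i
    have := Finset.ext_iff.mp heq i
    simp only [Finset.mem_filter, Finset.mem_univ, true_and, Finset.mem_erase, and_true] at this
    simp only [Set.mem_singleton_iff]
    tauto
  by_contra! hne
  have hj : j ≠ l := fun h => hne.1 (h ▸ hLl)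
  have hk : k ≠ l := fun h => hne.2 (h ▸ hLl)
  exact hjk (hinj (by simp [hLl, hj]) (by simp [hLl, hk]) hmjk)

open Classical in
/-- A dominant set with one element fewer than there are rankings has exactly two dominant
one-point extensions, provided there is always a point above the minima of all rankings but one. -/
theorem IsDominant.even_card_extensions {X I : Type*} [Fintype X] [Fintype I] {a : I → X → ℕ}
    (ha : ∀ i, Function.Injective (a i)) {D : Finset X} (hD : D.Nonempty)
    (hcard : D.card + 1 = Fintype.card I) (hdom : IsDominant a D)
    (habove : ∀ l, ∃ y, ∀ i ≠ l, ∃ x ∈ D, a i x < a i y) :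
    Even (Finset.univ.filter fun y => y ∉ D ∧ IsDominant a (insert y D)).card := by
  choose m hmD hmin using fun i => D.exists_min_image (a i) hD
  have hmono : ∀ {i y}, a i y ≤ a i (m i) → ∀ x ∈ D, a i y ≤ a i x :=
    fun h x hx => h.trans (hmin _ x hx)
  have hsurj : ∀ d ∈ D, ∃ i, m i = d := fun d hd => by
    obtain ⟨i, hi⟩ := hdom d
    exact ⟨i, ha i (le_antisymm (hmin i d hd) (hi _ (hmD i)))⟩
  obtain ⟨j, k, hjk, hmjk, hpair⟩ := exists_pair_of_surjective_card_add_one hcard hmD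
  let M : I → Finset X := fun l => Finset.univ.filter fun y => ∀ i ≠ l, a i (m i) < a i y
  have hM : ∀ l y, y ∈ M l ↔ ∀ i ≠ l, a i (m i) < a i y := fun l y => by simp [M]
  have hMne : ∀ l, (M l).Nonempty := fun l => by
    obtain ⟨y, hy⟩ := habove l
    refine ⟨y, (hM l y).mpr fun i hi => ?_⟩
    obtain ⟨x, hx, hlt⟩ := hy i hi
    exact (hmin i x hx).trans_lt hlt
  choose t htM htmax using fun l => (M l).exists_max_image (a l) (hMne l)
  have hext : ∀ l l', l ≠ l' → m l = m l' → t l ∉ D ∧ IsDominant a (insert (t l) D) := by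
    intro l l' hne heq
    constructor
    · intro hmem
      obtain ⟨i, hi⟩ := hsurj _ hmem
      have hlt := (hM l _).mp (htM l)
      by_cases hil : i = l
      · have := hlt l' hne.symm
        rw [← hi, hil, heq] at this
        exact lt_irrefl _ this
      · have := hlt i hil
        rw [hi] at this
        exact lt_irrefl _ this
    · intro z
      by_cases hz : z ∈ M l
      · obtain ⟨i, hi⟩ := hdom z
        have hil : i = l := by
          by_contra hil
          exact absurd ((hM l z).mp hz i hil) (not_lt.mpr (hi _ (hmD i)))
        subst hil
        refine ⟨i, fun x hx => ?_⟩
        rcases Finset.mem_insert.mp hx with rfl | hx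
        · exact htmax i z hz
        · exact hi x hx
      · simp only [hM, not_forall, not_lt] at hz
        obtain ⟨i, hil, hzi⟩ := hz
        refine ⟨i, fun x hx => ?_⟩
        rcases Finset.mem_insert.mp hx with rfl | hx
        · exact hzi.trans ((hM l _).mp (htM l) i hil).le
        · exact hmono hzi x hx
  have hset : (Finset.univ.filter fun y => y ∉ D ∧ IsDominant a (insert y D)) = {t j, t k} := by
    ext y
    simp only [Finset.mem_filter, Finset.mem_univ, true_and, Finset.mem_insert,
      Finset.mem_singleton]
    constructor
    · rintro ⟨hy, hydom⟩
      have hmain : ∀ l, {i | a i y < a i (m i)} = {l} → y = t l := by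
        intro l hl
        have hne : ∀ i, a i y ≠ a i (m i) := fun i h => hy (ha i h ▸ hmD i)
        have hyM : y ∈ M l := (hM l y).mpr fun i hi => by
          have : i ∉ {i | a i y < a i (m i)} := by rw [hl]; simpa using hi
          exact lt_of_le_of_ne (not_lt.mp this) (hne i).symm
        refine ha l (le_antisymm (htmax l y hyM) ?_)
        obtain ⟨i, hi⟩ := hydom (t l)
        have hil : i = l := by
          by_contra hil
          exact absurd ((hM l _).mp (htM l) i hil)
            (not_lt.mpr (hi _ (Finset.mem_insert_of_mem (hmD i))))
        exact hil ▸ hi y (Finset.mem_insert_self _ _)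
      have hL : {i | a i y < a i (m i)}.Nonempty := by
        obtain ⟨i, hi⟩ := hydom y
        exact ⟨i, lt_of_le_of_ne (hi _ (Finset.mem_insert_of_mem (hmD i)))
          fun h => hy (ha i h ▸ hmD i)⟩
      refine (hpair _ hL fun d hd => ?_).imp (hmain j) (hmain k)
      obtain ⟨i, hi⟩ := hydom d
      have hmi : m i = d := ha i (le_antisymm (hmin i d hd)
        (hi _ (Finset.mem_insert_of_mem (hmD i))))
      exact ⟨i, by simpa [hmi] using hi y (Finset.mem_insert_self _ _), hmi⟩
    · rintro (rfl | rfl)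
      · exact hext j k hjk hmjk
      · exact hext k j hjk.symm hmjk.symm
  have htne : t j ≠ t k := fun h => by
    obtain ⟨i, hi⟩ := hdom (t j)
    have hle := hi _ (hmD i)
    by_cases hij : i = j
    · exact absurd ((hM k _).mp (htM k) i (hij ▸ hjk)) (not_lt.mpr (h ▸ hle))
    · exact absurd ((hM j _).mp (htM j) i hij) (not_lt.mpr hle)
  rw [hset, Finset.card_pair htne]
  exact even_two

open Classical in
/-- If `c` does not map `R` onto all colours, an even number of points of `R` can be erased so that
the image becomes every colour but `k`. -/
theorem even_card_erase_image_eq {X I : Type*} [Fintype I] (c : X → I) (k : I)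
    {R : Finset X} (hcard : R.card = Fintype.card I) (hR : R.image c ≠ Finset.univ) :
    Even (R.filter fun y => (R.erase y).image c = Finset.univ.erase k).card := by
  rcases (R.filter fun y => (R.erase y).image c = Finset.univ.erase k).eq_empty_or_nonempty
    with h | ⟨y, hy⟩
  · simp [h]
  obtain ⟨hyR, hy⟩ := Finset.mem_filter.mp hy
  have hinj : Set.InjOn c (R.erase y : Finset X) := Finset.card_image_iff.mp (by
    rw [hy, Finset.card_erase_of_mem hyR, Finset.card_erase_of_mem (Finset.mem_univ k),
      Finset.card_univ, hcard])
  have hyk : c y ≠ k := fun h => hR (by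
    rw [← Finset.insert_erase hyR, Finset.image_insert, hy, h,
      Finset.insert_erase (Finset.mem_univ k)])
  obtain ⟨z, hz, hzy⟩ := Finset.mem_image.mp
    (show c y ∈ (R.erase y).image c by rw [hy]; simpa using hyk)
  obtain ⟨hzne, hzR⟩ := Finset.mem_erase.mp hz
  have hset : (R.filter fun y => (R.erase y).image c = Finset.univ.erase k) = {y, z} := by
    ext w
    simp only [Finset.mem_filter, Finset.mem_insert, Finset.mem_singleton]
    constructor
    · rintro ⟨hwR, hw⟩
      by_contra! hne
      have hwmem : w ∈ R.erase y := Finset.mem_erase.mpr ⟨hne.1, hwR⟩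
      have : c w ∈ (R.erase w).image c := by
        rw [hw, ← hy]; exact Finset.mem_image_of_mem c hwmem
      obtain ⟨v, hv, hvw⟩ := Finset.mem_image.mp this
      obtain ⟨hvne, hvR⟩ := Finset.mem_erase.mp hv
      by_cases hvy : v = y
      · exact hne.2 (hinj hwmem hz (by rw [← hvw, hvy, hzy]))
      · exact hvne (hinj (Finset.mem_erase.mpr ⟨hvy, hvR⟩) hwmem hvw)
    · rintro (rfl | rfl)
      · exact ⟨hyR, hy⟩
      · refine ⟨hzR, ?_⟩
        rw [← hy]
        ext i
        simp only [Finset.mem_image, Finset.mem_erase]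
        constructor
        · rintro ⟨v, ⟨hv, hvR⟩, rfl⟩
          by_cases hvy : v = y
          · exact ⟨w, ⟨hzne, hzR⟩, by rw [hzy, hvy]⟩
          · exact ⟨v, ⟨hvy, hvR⟩, rfl⟩
        · rintro ⟨v, ⟨hv, hvR⟩, rfl⟩
          by_cases hvw : v = w
          · exact ⟨y, ⟨hzne.symm, hyR⟩, by rw [hvw, hzy]⟩
          · exact ⟨v, ⟨hvw, hvR⟩, rfl⟩
  rw [hset, Finset.card_pair hzne.symm]
  exact even_two

open Classical in
/-- **Scarf's lemma.** The points `s i` are slack points: `s i` is lowest in the ranking `b i`, and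
above all non-slack points in every other ranking. -/
theorem exists_isDominant_image_eq_univ {X I : Type*} [Fintype X] [Fintype I] [Nonempty I]
    {b : I → X → ℕ} (hb : ∀ i, Function.Injective (b i)) {s : I → X}
    (hlow : ∀ i x, b i (s i) ≤ b i x)
    (hhigh : ∀ i j, j ≠ i → ∀ x ∉ Set.range s, b i x < b i (s j))
    (hne : ∃ x, x ∉ Set.range s) (c : X → I) (hc : ∀ i, c (s i) = i) :
    ∃ R : Finset X, IsDominant b R ∧ R.image c = Finset.univ := by
  by_contra! hcon
  obtain ⟨k⟩ := ‹Nonempty I›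
  have hs : Function.Injective s := fun i j h => by rw [← hc i, h, hc]
  have hnle : ∀ i, ∀ x ∉ Set.range s, ¬ b i x ≤ b i (s i) := fun i x hx h =>
    hx ⟨i, hb i (le_antisymm (hlow i x) h)⟩
  let doors : Finset (Finset X) := Finset.univ.filter fun D =>
    D.card + 1 = Fintype.card I ∧ IsDominant b D ∧ D.image c = Finset.univ.erase k
  let rooms : Finset (Finset X) := Finset.univ.filter fun R =>
    R.card = Fintype.card I ∧ IsDominant b R
  let above : Finset X → Finset X := fun D =>
    Finset.univ.filter fun y => y ∉ D ∧ IsDominant b (insert y D)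
  let below : Finset X → Finset X := fun R =>
    R.filter fun y => (R.erase y).image c = Finset.univ.erase k
  have hdoors : ∀ D, D ∈ doors ↔ D.card + 1 = Fintype.card I ∧ IsDominant b D ∧
      D.image c = Finset.univ.erase k := by simp [doors]
  have hrooms : ∀ R, R ∈ rooms ↔ R.card = Fintype.card I ∧ IsDominant b R := by simp [rooms]
  have habove : ∀ D y, y ∈ above D ↔ y ∉ D ∧ IsDominant b (insert y D) := by simp [above]
  have hbelow : ∀ R y, y ∈ below R ↔ y ∈ R ∧ (R.erase y).image c = Finset.univ.erase k := by
    simp [below]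
  have hcount : ∑ D ∈ doors, (above D).card = ∑ R ∈ rooms, (below R).card := by
    rw [← Finset.card_sigma, ← Finset.card_sigma]
    refine Finset.card_bij' (fun p _ => ⟨insert p.2 p.1, p.2⟩) (fun p _ => ⟨p.1.erase p.2, p.2⟩)
      ?_ ?_ ?_ ?_
    · rintro ⟨D, y⟩ h
      simp only [Finset.mem_sigma, hdoors, hrooms, habove, hbelow] at h ⊢
      obtain ⟨⟨h1, h2, h3⟩, h4, h5⟩ := h
      refine ⟨⟨by rw [Finset.card_insert_of_notMem h4, h1], h5⟩, Finset.mem_insert_self _ _, ?_⟩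
      rw [Finset.erase_insert h4, h3]
    · rintro ⟨R, y⟩ h
      simp only [Finset.mem_sigma, hdoors, hrooms, habove, hbelow] at h ⊢
      obtain ⟨⟨h1, h2⟩, h3, h4⟩ := h
      refine ⟨⟨by rw [Finset.card_erase_add_one h3, h1], h2.subset (Finset.erase_subset _ _), h4⟩,
        Finset.notMem_erase _ _, ?_⟩
      rwa [Finset.insert_erase h3]
    · rintro ⟨D, y⟩ h
      simp only [Finset.mem_sigma, habove] at h
      simp [Finset.erase_insert h.2.1]
    · rintro ⟨R, y⟩ h
      simp only [Finset.mem_sigma, hbelow] at h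
      simp [Finset.insert_erase h.2.1]
  have heven : Even (∑ R ∈ rooms, (below R).card) := Finset.even_sum _ fun R hR => by
    rw [hrooms] at hR
    exact even_card_erase_image_eq c k hR.1 (hcon R hR.2)
  let D₀ : Finset X := (Finset.univ.erase k).image s
  have hD₀ : ∀ x, x ∈ D₀ ↔ ∃ i ≠ k, s i = x := by simp [D₀]
  obtain ⟨t, htmem, htmax⟩ := (Finset.univ.filter fun x => x ∉ Set.range s).exists_max_image (b k)
    (by obtain ⟨x, hx⟩ := hne; exact ⟨x, by simpa using hx⟩)
  have ht : t ∉ Set.range s := (Finset.mem_filter.mp htmem).2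
  have htmax : ∀ x ∉ Set.range s, b k x ≤ b k t := fun x hx =>
    htmax x (Finset.mem_filter.mpr ⟨Finset.mem_univ _, hx⟩)
  have hdomt : IsDominant b (insert t D₀) := fun z => by
    by_cases hz : z ∈ Set.range s
    · obtain ⟨i, rfl⟩ := hz
      exact ⟨i, fun x _ => hlow i x⟩
    · refine ⟨k, fun x hx => ?_⟩
      rcases Finset.mem_insert.mp hx with rfl | hx
      · exact htmax z hz
      · obtain ⟨i, hi, rfl⟩ := (hD₀ x).mp hx
        exact (hhigh k i hi z hz).le
  have hD₀doors : D₀ ∈ doors := by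
    rw [hdoors]
    refine ⟨?_, hdomt.subset (Finset.subset_insert _ _), ?_⟩
    · rw [Finset.card_image_of_injective _ hs, Finset.card_erase_add_one (Finset.mem_univ k),
        Finset.card_univ]
    · rw [Finset.image_image, show c ∘ s = id from funext hc, Finset.image_id]
  have hodd : (above D₀).card = 1 := by
    rw [Finset.card_eq_one]
    refine ⟨t, ?_⟩
    ext y
    rw [habove, Finset.mem_singleton]
    constructor
    · rintro ⟨hy, hdom⟩
      have hys : y ∉ Set.range s := by
        rintro ⟨i, rfl⟩
        have hik : i = k := by
          by_contra hik
          exact hy ((hD₀ _).mpr ⟨i, hik, rfl⟩)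
        subst hik
        obtain ⟨l, hl⟩ := hdom t
        refine hnle l t ht (hl _ ?_)
        rw [Finset.mem_insert, hD₀]
        by_cases hli : l = i
        · exact Or.inl (hli ▸ rfl)
        · exact Or.inr ⟨l, hli, rfl⟩
      obtain ⟨i, hi⟩ := hdom t
      have hik : i = k := by
        by_contra hik
        exact hnle i t ht (hi _ (Finset.mem_insert_of_mem ((hD₀ _).mpr ⟨i, hik, rfl⟩)))
      subst hik
      exact hb i (le_antisymm (htmax y hys) (hi y (Finset.mem_insert_self _ _)))
    · rintro rfl
      refine ⟨fun h => ?_, hdomt⟩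
      obtain ⟨i, -, hi⟩ := (hD₀ _).mp h
      exact ht ⟨i, hi⟩
  have hrest : Even (∑ D ∈ doors.erase D₀, (above D).card) := Finset.even_sum _ fun D hD => by
    obtain ⟨hDne, hD⟩ := Finset.mem_erase.mp hD
    obtain ⟨hcard, hdom, himg⟩ := (hdoors D).mp hD
    obtain ⟨x, hx, hxs⟩ : ∃ x ∈ D, x ∉ Set.range s := by
      by_contra! hsub
      refine hDne (Finset.ext fun x => ?_)
      have hmem := fun i => Finset.ext_iff.mp himg i
      simp only [Finset.mem_image, Finset.mem_erase, Finset.mem_univ, and_true] at hmem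
      rw [hD₀]
      constructor
      · intro hx
        obtain ⟨i, rfl⟩ := hsub x hx
        exact ⟨i, (hmem i).mp ⟨s i, hx, hc i⟩, rfl⟩
      · rintro ⟨i, hi, rfl⟩
        obtain ⟨y, hy, hyi⟩ := (hmem i).mpr hi
        obtain ⟨j, rfl⟩ := hsub y hy
        rw [hc] at hyi
        exact hyi ▸ hy
    exact hdom.even_card_extensions hb ⟨x, hx⟩ hcard
      fun l => ⟨s l, fun i hi => ⟨x, hx, hhigh i l hi.symm x hxs⟩⟩
  rw [← hcount, ← Finset.add_sum_erase _ _ hD₀doors, hodd] at heven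
  exact absurd heven (by simpa [Nat.even_add_one, add_comm 1] using hrest)

/-- A coloured version of Scarf's lemma, without slack points. -/
theorem exists_colorful_dominant {T I : Type*} [Fintype T] [Nonempty T] [Fintype I] [Nonempty I]
    {a : I → T → ℕ} (ha : ∀ i, Function.Injective (a i)) (c : T → I) :
    ∃ (C : Set I) (x : I → T), (∀ i ∈ C, c (x i) = i) ∧
      ∀ y, ∃ i ∈ C, ∀ j ∈ C, a i y ≤ a i (x j) := by
  classical
  let e := Fintype.equivFin I
  obtain ⟨B, hB⟩ : ∃ B, ∀ i t, a i t < B := by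
    obtain ⟨B, hB⟩ := (Set.finite_range fun p : I × T => a p.1 p.2).bddAbove
    exact ⟨B + 1, fun i t => Nat.lt_succ_of_le (hB ⟨(i, t), rfl⟩)⟩
  let b : I → T ⊕ I → ℕ := fun i =>
    Sum.elim (fun t => a i t + 1) fun j => if j = i then 0 else B + 1 + e j
  have hb : ∀ i, Function.Injective (b i) := by
    rintro i (t | j) (t' | j') h
    · exact congrArg _ (ha i (by simpa [b] using h))
    · have := hB i t
      simp only [b, Sum.elim_inl, Sum.elim_inr] at h
      split_ifs at h; omega
    · have := hB i t'
      simp only [b, Sum.elim_inl, Sum.elim_inr] at h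
      split_ifs at h; omega
    · simp only [b, Sum.elim_inr] at h
      split_ifs at h with h1 h2 h2
      · rw [h1, h2]
      · omega
      · omega
      · exact congrArg _ (e.injective (Fin.ext (by omega)))
  obtain ⟨R, hR, himg⟩ := exists_isDominant_image_eq_univ hb (s := Sum.inr)
    (fun i x => by simp [b])
    (by
      rintro i j hji (t | l) hx
      · have := hB i t
        simp only [b, Sum.elim_inl, Sum.elim_inr, if_neg hji]
        omega
      · exact absurd ⟨l, rfl⟩ hx)
    ⟨Sum.inl (Classical.arbitrary T), by simp⟩ (Sum.elim c id) (fun _ => rfl)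
  have hx : ∀ i, ∃ t, Sum.inr i ∉ R → Sum.inl t ∈ R ∧ c t = i := fun i => by
    by_cases hi : Sum.inr i ∈ R
    · exact ⟨Classical.arbitrary T, fun h => absurd hi h⟩
    · obtain ⟨t | j, ht, hti⟩ := Finset.mem_image.mp
        (show i ∈ R.image (Sum.elim c id) by rw [himg]; exact Finset.mem_univ i)
      · exact ⟨t, fun _ => ⟨ht, hti⟩⟩
      · exact absurd ((show j = i from hti) ▸ ht) hi
  choose x hx using hx
  refine ⟨{i | Sum.inr i ∉ R}, x, fun i hi => (hx i hi).2, fun y => ?_⟩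
  obtain ⟨i, hi⟩ := hR (Sum.inl y)
  refine ⟨i, fun h => ?_, fun j hj => ?_⟩
  · have := hi _ h
    simp [b] at this
  · simpa [b] using hi _ (hx j hj).1

/-- Grid points of the simplex of side `N`, one for each colour, at bounded distance of each other:
each has its own colour or is close to the opposite face. -/
theorem exists_colored_grid_points {I : Type*} [Fintype I] [Nonempty I] (N : ℕ)
    (c : (I → ℕ) → I) :
    ∃ x : I → I → ℕ, (∀ j, ∑ i, x j i = N) ∧
      (∀ i j k, x j i ≤ x k i + Fintype.card I) ∧
      ∀ i, c (x i) = i ∨ x i i ≤ Fintype.card I := by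
  classical
  let G := Finset.piAntidiag (Finset.univ : Finset I) N
  have hG : ∀ f, f ∈ G ↔ ∑ i, f i = N := fun f => by simp [G, Finset.mem_piAntidiag]
  obtain ⟨k⟩ := ‹Nonempty I›
  have : Nonempty G := ⟨⟨Pi.single k N, by simp [hG]⟩⟩
  let e := Fintype.equivFin G
  let a : I → G → ℕ := fun i t => e t + Fintype.card G * t.1 i
  have ha : ∀ i, Function.Injective (a i) := fun i t t' h => by
    have h' := congrArg (· % Fintype.card G) h
    simp only [a, Nat.add_mul_mod_self_left, Nat.mod_eq_of_lt (e _).2] at h'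
    exact e.injective (Fin.ext h')
  have hale : ∀ i t t', a i t ≤ a i t' → t.1 i ≤ t'.1 i := fun i t t' h => by
    have hpos : 0 < Fintype.card G := Fintype.card_pos
    have h' := Nat.div_le_div_right (c := Fintype.card G) h
    simpa only [a, Nat.add_mul_div_left _ _ hpos, Nat.div_eq_of_lt (e _).2, zero_add] using h'
  have : Nonempty I := ⟨k⟩
  obtain ⟨C, p, hpc, hdom⟩ := exists_colorful_dominant ha (fun t : G => c t.1)
  obtain ⟨i₀, hi₀, -⟩ := hdom (Classical.arbitrary G)
  let x : I → I → ℕ := fun j => if j ∈ C then (p j).1 else (p i₀).1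
  have hxp : ∀ j, ∃ l ∈ C, x j = (p l).1 := fun j => by
    by_cases hj : j ∈ C
    · exact ⟨j, hj, if_pos hj⟩
    · exact ⟨i₀, hi₀, if_neg hj⟩
  have hxsum : ∀ j, ∑ i, x j i = N := fun j => by
    obtain ⟨l, -, hl⟩ := hxp j
    rw [hl]
    exact (hG _).mp (p l).2
  have hxdom : ∀ y : I → ℕ, ∑ i, y i = N → ∃ i ∈ C, ∀ j, y i ≤ x j i := fun y hy => by
    obtain ⟨i, hi, h⟩ := hdom ⟨y, (hG y).mpr hy⟩
    refine ⟨i, hi, fun j => ?_⟩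
    obtain ⟨l, hl, hjl⟩ := hxp j
    rw [hjl]
    exact hale i _ _ (h l hl)
  choose m _ hm using fun i =>
    (Finset.univ : Finset I).exists_min_image (fun j => x j i) Finset.univ_nonempty
  let w : I → ℕ := fun i => if i ∈ C then x (m i) i else 0
  have hw : ∀ i j, w i ≤ x j i := fun i j => by
    simp only [w]
    split_ifs
    · exact hm i j (Finset.mem_univ j)
    · exact Nat.zero_le _
  have hlt : N < ∑ i, w i + Fintype.card I := by
    by_contra! hle
    let y : I → ℕ := fun i => (w i + 1) +
      if i = i₀ then N - (∑ i, w i + Fintype.card I) else 0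
    have hy : ∑ i, y i = N := by
      simp only [y, Finset.sum_add_distrib, Finset.sum_ite_eq', Finset.mem_univ, if_true,
        Finset.sum_const, Finset.card_univ, smul_eq_mul, mul_one]
      omega
    obtain ⟨i, hi, h⟩ := hxdom y hy
    have := h (m i)
    simp only [y, w, if_pos hi] at this
    omega
  have hclose : ∀ i j, x j i ≤ w i + Fintype.card I := fun i j => by
    have h := Finset.sum_le_sum fun l (_ : l ∈ Finset.univ.erase i) => hw l j
    have h1 := Finset.add_sum_erase Finset.univ w (Finset.mem_univ i)
    have h2 := Finset.add_sum_erase Finset.univ (x j) (Finset.mem_univ i)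
    have h3 := hxsum j
    omega
  refine ⟨x, hxsum, fun i j k => (hclose i j).trans (by have := hw i k; omega), fun i => ?_⟩
  by_cases hi : i ∈ C
  · left
    simpa [x, hi] using hpc i hi
  · right
    simpa [w, hi] using hclose i i

/-- **Brouwer's fixed point theorem** for the standard simplex. -/
theorem exists_fixedPoint_stdSimplex {I : Type*} [Fintype I] [Nonempty I]
    {f : (I → ℝ) → I → ℝ} (hf : ContinuousOn f (stdSimplex ℝ I))
    (hmaps : Set.MapsTo f (stdSimplex ℝ I) (stdSimplex ℝ I)) :
    ∃ x ∈ stdSimplex ℝ I, f x = x := by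
  have hcol : ∀ x ∈ stdSimplex ℝ I, ∃ i, x i ≤ f x i := fun x hx => by
    by_contra! h
    have := Finset.sum_lt_sum_of_nonempty Finset.univ_nonempty fun i (_ : i ∈ Finset.univ) => h i
    rw [hx.2, (hmaps hx).2] at this
    exact lt_irrefl _ this
  let n : ℝ := Fintype.card I
  have happrox : ∀ N : ℕ, ∃ p : I → I → ℝ, (∀ j, p j ∈ stdSimplex ℝ I) ∧
      (∀ i j k, p j i ≤ p k i + n / (N + 1)) ∧ ∀ i, p i i ≤ f (p i) i + n / (N + 1) := by
    intro N
    have hN : (0 : ℝ) < N + 1 := by positivity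
    let g : (I → ℕ) → I → ℝ := fun x i => x i / (N + 1)
    have hg : ∀ x : I → ℕ, ∑ i, x i = N + 1 → g x ∈ stdSimplex ℝ I := fun x hx => by
      refine ⟨fun i => by positivity, ?_⟩
      rw [← Finset.sum_div, div_eq_one_iff_eq hN.ne']
      exact_mod_cast hx
    have hc : ∀ x, ∃ i, ∑ i, x i = N + 1 → g x i ≤ f (g x) i := fun x => by
      by_cases hx : ∑ i, x i = N + 1
      · exact (hcol _ (hg x hx)).imp fun _ h _ => h
      · exact ⟨Classical.arbitrary I, fun h => absurd h hx⟩
    choose c hc using hc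
    obtain ⟨x, hsum, hclose, hx⟩ := exists_colored_grid_points (N + 1) c
    refine ⟨fun j => g (x j), fun j => hg _ (hsum j), fun i j k => ?_, fun i => ?_⟩
    · simp only [g, n]
      rw [← add_div]
      gcongr
      exact_mod_cast hclose i j k
    · rcases hx i with h | h
      · have := hc (x i) (hsum i)
        rw [h] at this
        have : 0 ≤ n / (N + 1) := by positivity
        linarith
      · have h1 : g (x i) i ≤ n / (N + 1) := by
          simp only [g, n]
          gcongr
        have := (hmaps (hg _ (hsum i))).1 i
        linarith
  choose p hp hclose hfp using happrox
  obtain ⟨q, hq, φ, hφ, hlim⟩ :=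
    (isCompact_univ_pi fun _ : I => isCompact_stdSimplex ℝ I).tendsto_subseq
      (x := p) fun N => Set.mem_univ_pi.mpr (hp N)
  rw [Set.mem_univ_pi] at hq
  have hlimj : ∀ j, Filter.Tendsto (fun N => p (φ N) j) Filter.atTop (nhds (q j)) :=
    fun j => tendsto_pi_nhds.mp hlim j
  have hlimji : ∀ j i, Filter.Tendsto (fun N => p (φ N) j i) Filter.atTop (nhds (q j i)) :=
    fun j i => tendsto_pi_nhds.mp (hlimj j) i
  have herr : Filter.Tendsto (fun N => n / ((φ N : ℝ) + 1)) Filter.atTop (nhds 0) := by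
    have h : Filter.Tendsto (fun N : ℕ => n / ((N : ℝ) + 1)) Filter.atTop (nhds 0) :=
      Filter.Tendsto.div_atTop tendsto_const_nhds
        (Filter.tendsto_atTop_add_const_right _ _ tendsto_natCast_atTop_atTop)
    exact h.comp hφ.tendsto_atTop
  have hqle : ∀ i j k, q j i ≤ q k i := fun i j k => by
    have := le_of_tendsto_of_tendsto' (hlimji j i) ((hlimji k i).add herr)
      fun N => hclose (φ N) i j k
    simpa using this
  have hqf : ∀ i, q i i ≤ f (q i) i := fun i => by
    have h1 : Filter.Tendsto (fun N => f (p (φ N) i)) Filter.atTop (nhds (f (q i))) :=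
      (hf _ (hq i)).tendsto.comp (tendsto_nhdsWithin_iff.mpr
        ⟨hlimj i, Filter.Eventually.of_forall fun N => hp _ i⟩)
    have := le_of_tendsto_of_tendsto' (hlimji i i) ((tendsto_pi_nhds.mp h1 i).add herr)
      fun N => hfp (φ N) i
    simpa using this
  let k := Classical.arbitrary I
  have hqk : ∀ j, q j = q k := fun j => funext fun i => le_antisymm (hqle i j k) (hqle i k j)
  refine ⟨q k, hq k, funext fun i => ?_⟩
  have hle : ∀ i ∈ Finset.univ, q k i ≤ f (q k) i := fun i _ => by
    have := hqf i
    rwa [hqk i] at this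
  exact ((Finset.sum_eq_sum_iff_of_le hle).mp
    (by rw [(hq k).2, (hmaps (hq k)).2]) i (Finset.mem_univ i)).symm

/-- **Brouwer's fixed point theorem** for a finite product of standard simplices. -/
theorem exists_fixedPoint_pi_stdSimplex {ι : Type*} [Fintype ι] {S : ι → Type*}
    [∀ i, Fintype (S i)] [∀ i, Nonempty (S i)]
    {f : (∀ i, S i → ℝ) → ∀ i, S i → ℝ} (hf : ContinuousOn f {q | ∀ i, q i ∈ stdSimplex ℝ (S i)})
    (hmaps : ∀ q, (∀ i, q i ∈ stdSimplex ℝ (S i)) → ∀ i, f q i ∈ stdSimplex ℝ (S i)) :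
    ∃ q, (∀ i, q i ∈ stdSimplex ℝ (S i)) ∧ f q = q := by
  rcases isEmpty_or_nonempty ι with hι | hι
  · exact ⟨isEmptyElim, isEmptyElim, Subsingleton.elim _ _⟩
  let κ : ℝ := (Fintype.card ι : ℝ)⁻¹
  have hκ : 0 < κ := by simp only [κ]; positivity
  let μ : ((Σ i, S i) → ℝ) → ι → ℝ := fun x i => ∑ s, x ⟨i, s⟩
  let r : ((Σ i, S i) → ℝ) → ∀ i, S i → ℝ := fun x i s =>
    (x ⟨i, s⟩ + max 0 (κ - μ x i) / Fintype.card (S i)) / max κ (μ x i)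
  let E : (∀ i, S i → ℝ) → (Σ i, S i) → ℝ := fun q a => κ * q a.1 a.2
  have hden : ∀ x i, 0 < max κ (μ x i) := fun x i => hκ.trans_le (le_max_left _ _)
  have hr : Continuous r := by
    refine continuous_pi fun i => continuous_pi fun s => Continuous.div ?_ ?_ fun x => (hden x i).ne'
    · fun_prop
    · fun_prop
  have hE : Continuous E := by fun_prop
  have hrmem : ∀ x ∈ stdSimplex ℝ (Σ i, S i), ∀ i, r x i ∈ stdSimplex ℝ (S i) := fun x hx i => by
    refine ⟨fun s => ?_, ?_⟩
    · have := hx.1 ⟨i, s⟩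
      have := hden x i
      positivity
    · have hcard : (Fintype.card (S i) : ℝ) ≠ 0 := by simp
      simp only [r]
      rw [← Finset.sum_div, Finset.sum_add_distrib, Finset.sum_const, Finset.card_univ,
        nsmul_eq_mul, mul_div_cancel₀ _ hcard, div_eq_one_iff_eq (hden x i).ne']
      change μ x i + _ = _
      rcases le_total κ (μ x i) with h | h
      · rw [max_eq_left (by linarith), max_eq_right h, add_zero]
      · rw [max_eq_right (by linarith), max_eq_left h]
        ring
  have hEmem : ∀ q, (∀ i, q i ∈ stdSimplex ℝ (S i)) → E q ∈ stdSimplex ℝ (Σ i, S i) :=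
    fun q hq => by
      refine ⟨fun a => mul_nonneg hκ.le ((hq a.1).1 a.2), ?_⟩
      simp only [E]
      rw [Fintype.sum_sigma]
      simp only [← Finset.mul_sum, (hq _).2]
      simp [κ]
  have hrE : ∀ q, (∀ i, q i ∈ stdSimplex ℝ (S i)) → r (E q) = q := fun q hq => by
    funext i s
    have hμ : μ (E q) i = κ := by
      simp only [μ, E]
      rw [← Finset.mul_sum, (hq i).2, mul_one]
    simp only [r, hμ, E]
    simp [hκ.ne']
  obtain ⟨i⟩ := id hι
  have : Nonempty (Σ i, S i) := ⟨⟨i, Classical.arbitrary _⟩⟩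
  obtain ⟨x, hx, hfix⟩ := exists_fixedPoint_stdSimplex (f := fun x => E (f (r x)))
    (hE.comp_continuousOn (hf.comp hr.continuousOn hrmem))
    (fun x hx => hEmem _ (hmaps _ (hrmem x hx)))
  refine ⟨r x, hrmem x hx, ?_⟩
  rw [← hrE _ (hmaps _ (hrmem x hx)), hfix]

open Classical in
/-- Expected utility is affine in the strategy of one player. -/
theorem sum_prod_update_mul {ι : Type*} [Fintype ι] [DecidableEq ι] {S : ι → Type*}
    [∀ i, Fintype (S i)] (v : (∀ j, S j) → ℝ) (q : ∀ j, S j → ℝ) (i : ι) (q' : S i → ℝ) :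
    ∑ s : ∀ j, S j, (∏ j, Function.update q i q' j (s j)) * v s =
      ∑ t, q' t * ∑ s : ∀ j, S j,
        (∏ j, Function.update q i (Pi.single t 1) j (s j)) * v s := by
  have h : ∀ (q' : S i → ℝ) (s : ∀ j, S j), ∏ j, Function.update q i q' j (s j) =
      q' (s i) * ∏ j ∈ Finset.univ.erase i, q j (s j) := fun q' s => by
    rw [← Finset.mul_prod_erase _ _ (Finset.mem_univ i), Function.update_self]
    congr 1
    refine Finset.prod_congr rfl fun j hj => ?_
    rw [Function.update_of_ne (Finset.ne_of_mem_erase hj)]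
  simp only [h, Finset.mul_sum]
  rw [Finset.sum_comm]
  refine Finset.sum_congr rfl fun s _ => ?_
  simp [Pi.single_apply, mul_assoc]

/-- **Nash (1950).** Every finite strategic-form game (finitely many players, each with a
nonempty finite strategy set, arbitrary real-valued utilities) possesses a mixed-strategy
Nash equilibrium. Mixed strategies are points of the standard simplex on each strategy set,
and expected utilities are computed with independent randomization. -/
theorem nash_existence_mixed_equilibrium
    {K : ℕ} (S : Fin K → Type) [∀ i, Fintype (S i)] [∀ i, Nonempty (S i)]
    (u : ∀ _ : Fin K, (∀ j : Fin K, S j) → ℝ) :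
    ∃ q : ∀ i : Fin K, S i → ℝ,
      (∀ i, q i ∈ stdSimplex ℝ (S i)) ∧
      ∀ i, ∀ q' ∈ stdSimplex ℝ (S i),
        (∑ s : ∀ j, S j, (∏ j, Function.update q i q' j (s j)) * u i s) ≤
        (∑ s : ∀ j, S j, (∏ j, q j (s j)) * u i s) := by
  classical
  let U : Fin K → (∀ i, S i → ℝ) → ℝ := fun i q => ∑ s : ∀ j, S j, (∏ j, q j (s j)) * u i s
  let V : ∀ i, S i → (∀ i, S i → ℝ) → ℝ := fun i t q => U i (Function.update q i (Pi.single t 1))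
  let g : ∀ i, S i → (∀ i, S i → ℝ) → ℝ := fun i t q => max 0 (V i t q - U i q)
  have hUV : ∀ q i q', U i (Function.update q i q') = ∑ t, q' t * V i t q :=
    fun q i q' => sum_prod_update_mul (u i) q i q'
  have hU : ∀ i, Continuous (U i) := fun i => by fun_prop
  have hV : ∀ i t, Continuous (V i t) := fun i t =>
    (hU i).comp (continuous_id.update i continuous_const)
  have hg : ∀ i t, Continuous (g i t) := fun i t =>
    continuous_const.max ((hV i t).sub (hU i))
  have hg0 : ∀ i t q, 0 ≤ g i t q := fun i t q => le_max_left _ _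
  have hG0 : ∀ i q, 0 ≤ ∑ t, g i t q := fun i q => Finset.sum_nonneg fun t _ => hg0 i t q
  have hden : ∀ i q, 0 < 1 + ∑ t, g i t q := fun i q => by linarith [hG0 i q]
  obtain ⟨q, hq, hfix⟩ := exists_fixedPoint_pi_stdSimplex
    (f := fun q i t => (q i t + g i t q) / (1 + ∑ t, g i t q))
    (by
      refine Continuous.continuousOn (continuous_pi fun i => continuous_pi fun t => ?_)
      exact Continuous.div (by fun_prop) (by fun_prop) fun q => (hden i q).ne')
    (fun q hq i => ⟨fun t => div_nonneg (add_nonneg ((hq i).1 t) (hg0 i t q)) (hden i q).le, by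
      rw [← Finset.sum_div, Finset.sum_add_distrib, (hq i).2, div_self (hden i q).ne']⟩)
  refine ⟨q, hq, fun i q' hq' => ?_⟩
  change U i (Function.update q i q') ≤ U i q
  have hgain : ∀ t, q i t * ∑ t, g i t q = g i t q := fun t => by
    have h := congrFun (congrFun hfix i) t
    rw [div_eq_iff (hden i q).ne'] at h
    linarith
  have hself : U i q = ∑ t, q i t * V i t q := by
    rw [← hUV, Function.update_eq_self]
  obtain ⟨t, ht, htle⟩ : ∃ t, 0 < q i t ∧ V i t q ≤ U i q := by
    by_contra! h
    have hle : ∀ t ∈ Finset.univ, q i t * U i q ≤ q i t * V i t q := fun t _ => by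
      rcases ((hq i).1 t).eq_or_lt with h0 | h0
      · simp [← h0]
      · exact mul_le_mul_of_nonneg_left (h t h0).le h0.le
    have hsum : ∑ t, q i t * U i q = ∑ t, q i t * V i t q := by
      rw [← Finset.sum_mul, (hq i).2, one_mul, ← hself]
    have heq := (Finset.sum_eq_sum_iff_of_le hle).mp hsum
    have hzero : ∀ t, q i t = 0 := fun t => by
      by_contra h0
      have hpos := lt_of_le_of_ne ((hq i).1 t) (Ne.symm h0)
      exact (h t hpos).ne (mul_left_cancel₀ h0 (heq t (Finset.mem_univ t)))
    have := (hq i).2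
    simp [hzero] at this
  have hGzero : ∑ t, g i t q = 0 := by
    have h := hgain t
    rw [show g i t q = 0 from max_eq_left (by linarith)] at h
    exact (mul_eq_zero.mp h).resolve_left ht.ne'
  have hVle : ∀ t, V i t q ≤ U i q := fun t => by
    have h := hgain t
    rw [hGzero, mul_zero] at h
    have := le_max_right 0 (V i t q - U i q)
    have : g i t q = max 0 (V i t q - U i q) := rfl
    linarith
  calc U i (Function.update q i q') = ∑ t, q' t * V i t q := hUV q i q'
    _ ≤ ∑ t, q' t * U i q :=
      Finset.sum_le_sum fun t _ => mul_le_mul_of_nonneg_left (hVle t) (hq'.1 t)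
    _ = U i q := by rw [← Finset.sum_mul, hq'.2, one_mul]
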